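/- The sign character χ(q) := e((q₅+q₆+q₇)'·q'') applied to the four even forms q_{i67} := q_i+q₆+q₇ (i=1,…,4) satisfies χ(q_{i67}) = e(a(q₆)+a(q₇))·χ(q_i)·(reduction signs), so that in the addition-formula expansion with u=0 and n₁=(q₅+q₆), n₂=(q₅+q₇), n₃=(q₆+q₇), n₄=0, the contributions of the six odd forms q_{jk} (j<k ≤ 4) cancel against those of the six even forms q_{5jk}, and the contributions of q₁,…,q₄ equal those of q_{167},…,q_{467}; hence Σ_{k=1}^4 χ(q_k) θ(q₅+q₆+q_k)θ(q₅+q₇+q_k)θ(q₆+q₇+q_k)(z) θ[q_k](z) = 0 for all z ∈ ℂ³. -/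

import Mathlib

open Complex

/-- The Riemann theta function with integer characteristic `(m', m'')`. -/
noncomputable def SiegelTheta (g : ℕ) (τ : Matrix (Fin g) (Fin g) ℂ)
    (z : Fin g → ℂ) (m' m'' : Fin g → ℤ) : ℂ :=
  ∑' n : Fin g → ℤ,
    Complex.exp (Real.pi * Complex.I *
      ((∑ i, ∑ j, ((n i : ℂ) + (m' i : ℂ) / 2) * τ i j * ((n j : ℂ) + (m' j : ℂ) / 2)) +
        2 * ∑ i, ((n i : ℂ) + (m' i : ℂ) / 2) * (z i + (m'' i : ℂ) / 2)))

/-- `τ` belongs to the Siegel upper half space. -/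
def InSiegelUpperHalfSpace {g : ℕ} (τ : Matrix (Fin g) (Fin g) ℂ) : Prop :=
  (∀ i j, τ i j = τ j i) ∧
  (∀ x : Fin g → ℝ, x ≠ 0 → 0 < ∑ i, ∑ j, x i * (τ i j).im * x j)

/-- The `i`-th component of the gradient of `θ_m(τ, ·)` at `z = 0`. -/
noncomputable def thetaGrad (g : ℕ) (τ : Matrix (Fin g) (Fin g) ℂ)
    (m' m'' : Fin g → ℤ) (i : Fin g) : ℂ :=
  fderiv ℂ (fun z : Fin g → ℂ => SiegelTheta g τ z m' m'') 0 (Pi.single i 1)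

/-- The Jacobian determinant `D[q_a, q_b, q_c]` of three theta gradients at
`z = 0`, for genus 3 and characteristics `c k = (m'_k, m''_k)`. -/
noncomputable def thetaJacDet (τ : Matrix (Fin 3) (Fin 3) ℂ)
    (c : Fin 3 → (Fin 3 → ℤ) × (Fin 3 → ℤ)) : ℂ :=
  Matrix.det (Matrix.of fun k i => thetaGrad 3 τ (c k).1 (c k).2 i)

/-- The theta constant `θ(q_a + q_b + q_c)` with the non-reduced characteristic
given by the integer sum of the three characteristics. -/
noncomputable def tripleThetaConst (τ : Matrix (Fin 3) (Fin 3) ℂ)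
    (m' m'' : Fin 7 → Fin 3 → ℤ) (a b c : Fin 7) : ℂ :=
  SiegelTheta 3 τ 0 (fun i => m' a i + m' b i + m' c i)
    (fun i => m'' a i + m'' b i + m'' c i)

/-- `(m', m'')` is a (genus 3) Aronhold system of characteristics: seven
distinct odd characteristics with entries in `{0, 1}`, every three of which are
azygetic (the characteristic sum of any three of them is even). -/
def IsAronholdChar (m' m'' : Fin 7 → Fin 3 → ℤ) : Prop :=
  (∀ k i, m' k i = 0 ∨ m' k i = 1) ∧
  (∀ k i, m'' k i = 0 ∨ m'' k i = 1) ∧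
  (∀ k, Odd (∑ i, m' k i * m'' k i)) ∧
  (∀ a b c : Fin 7, a ≠ b → a ≠ c → b ≠ c →
    Even (∑ i, (m' a i + m' b i + m' c i) * (m'' a i + m'' b i + m'' c i))) ∧
  Function.Injective (fun k => (m' k, m'' k))


lemma summable_prod_pi {g : ℕ} (f : Fin g → ℤ → ℝ) (h0 : ∀ i n, 0 ≤ f i n)
    (hf : ∀ i, Summable (f i)) : Summable (fun n : Fin g → ℤ => ∏ i, f i (n i)) := by
  induction g with
  | zero => exact summable_of_finite_support (Set.toFinite _)
  | succ g ih =>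
    rw [← (Fin.consEquiv (fun _ : Fin (g+1) => ℤ)).summable_iff]
    have h1 := (hf 0).mul_of_nonneg (ih (fun i => f i.succ) (fun i => h0 _) (fun i => hf _))
      (fun n => h0 0 n) (fun n => Finset.prod_nonneg fun i _ => h0 _ _)
    refine h1.congr ?_
    intro b
    simp [Fin.consEquiv, Fin.prod_univ_succ]

lemma posdef_bound {g : ℕ} (A : Fin g → Fin g → ℝ)
    (h : ∀ x : Fin g → ℝ, x ≠ 0 → 0 < ∑ i, ∑ j, x i * A i j * x j) :
    ∃ c : ℝ, 0 < c ∧ ∀ x : Fin g → ℝ, c * ∑ i, x i ^ 2 ≤ ∑ i, ∑ j, x i * A i j * x j := by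
  let q : (Fin g → ℝ) → ℝ := fun x => ∑ i, ∑ j, x i * A i j * x j
  have hq : Continuous q := by fun_prop
  have hS : ∃ c : ℝ, 0 < c ∧ ∀ x ∈ Metric.sphere (0 : Fin g → ℝ) 1, c ≤ q x := by
    rcases (Metric.sphere (0 : Fin g → ℝ) 1).eq_empty_or_nonempty with he | hne
    · exact ⟨1, one_pos, by simp [he]⟩
    · obtain ⟨x, hx, hm⟩ := (isCompact_sphere (0 : Fin g → ℝ) 1).exists_isMinOn hne hq.continuousOn
      refine ⟨q x, h x ?_, fun y hy => hm hy⟩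
      rintro rfl
      simp at hx
  obtain ⟨c, hc, hcS⟩ := hS
  have key : ∀ x : Fin g → ℝ, c * ‖x‖ ^ 2 ≤ q x := by
    intro x
    by_cases hx : x = 0
    · subst hx; simp [q]
    have hn : 0 < ‖x‖ := norm_pos_iff.2 hx
    have h1 := hcS (‖x‖⁻¹ • x) (by simp [norm_smul, hn.ne'])
    have h2 : q (‖x‖⁻¹ • x) = (‖x‖⁻¹) ^ 2 * q x := by
      simp only [q, Finset.mul_sum, Pi.smul_apply, smul_eq_mul]
      refine Finset.sum_congr rfl fun i _ => Finset.sum_congr rfl fun j _ => ?_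
      ring
    rw [h2, inv_pow, ← div_eq_inv_mul, le_div_iff₀ (by positivity)] at h1
    exact h1
  refine ⟨c / (g + 1), by positivity, fun x => le_trans ?_ (key x)⟩
  have h3 : ∑ i, x i ^ 2 ≤ (g + 1) * ‖x‖ ^ 2 := by
    calc ∑ i, x i ^ 2 ≤ ∑ i : Fin g, ‖x‖ ^ 2 := by
          refine Finset.sum_le_sum fun i _ => ?_
          rw [← sq_abs (x i)]
          exact pow_le_pow_left₀ (abs_nonneg _) (norm_le_pi_norm x i) 2
      _ = g * ‖x‖ ^ 2 := by simp
      _ ≤ _ := by nlinarith [sq_nonneg ‖x‖]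
  rw [div_mul_eq_mul_div, div_le_iff₀ (by positivity)]
  nlinarith

lemma summable_one_dim (c s b : ℝ) (hc : 0 < c) :
    Summable (fun n : ℤ => Real.exp (-Real.pi * (c * (n + s) ^ 2 + 2 * (n + s) * b))) := by
  have h := ((summable_jacobiTheta₂_term_iff (I * (c * s + b : ℝ)) (I * (c : ℝ))).2
    (by simpa using hc)).norm.mul_left (Real.exp (-Real.pi * (c * s ^ 2 + 2 * s * b)))
  refine h.congr fun n => ?_
  rw [norm_jacobiTheta₂_term, ← Real.exp_add]
  congr 1
  simp
  ring

/-- The general term of the theta series. -/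
noncomputable def thE {g : ℕ} (τ : Matrix (Fin g) (Fin g) ℂ) (z : Fin g → ℂ)
    (m' m'' n : Fin g → ℤ) : ℂ :=
    Complex.exp (Real.pi * Complex.I *
      ((∑ i, ∑ j, ((n i : ℂ) + (m' i : ℂ) / 2) * τ i j * ((n j : ℂ) + (m' j : ℂ) / 2)) +
        2 * ∑ i, ((n i : ℂ) + (m' i : ℂ) / 2) * (z i + (m'' i : ℂ) / 2)))

lemma theta_eq {g : ℕ} (τ : Matrix (Fin g) (Fin g) ℂ) (z : Fin g → ℂ) (m' m'' : Fin g → ℤ) :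
    SiegelTheta g τ z m' m'' = ∑' n, thE τ z m' m'' n := rfl

lemma summable_thE {g : ℕ} (τ : Matrix (Fin g) (Fin g) ℂ) (hτ : InSiegelUpperHalfSpace τ)
    (z : Fin g → ℂ) (m' m'' : Fin g → ℤ) : Summable (fun n => ‖thE τ z m' m'' n‖) := by
  obtain ⟨c, hc, hb⟩ := posdef_bound (fun i j => (τ i j).im) hτ.2
  refine Summable.of_nonneg_of_le (fun _ => norm_nonneg _) ?_
    (summable_prod_pi (fun i n => Real.exp (-Real.pi * (c * (n + (m' i : ℝ) / 2) ^ 2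
      + 2 * (n + (m' i : ℝ) / 2) * (z i).im))) (fun _ _ => (Real.exp_pos _).le)
      (fun i => summable_one_dim _ _ _ hc))
  intro n
  rw [thE, Complex.norm_exp, ← Real.exp_sum, Real.exp_le_exp, ← Finset.mul_sum]
  have h1 := hb (fun i => (n i : ℝ) + (m' i : ℝ) / 2)
  have e1 : ∀ S : ℂ, (Real.pi * Complex.I * S).re = - Real.pi * S.im := by
    intro S; simp
  have ec : ∀ i, ((n i : ℂ) + (m' i : ℂ) / 2) = (((n i : ℝ) + (m' i : ℝ) / 2 : ℝ) : ℂ) := by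
    intro i; push_cast; rfl
  have ed : ∀ i, ((m'' i : ℂ) / 2) = (((m'' i : ℝ) / 2 : ℝ) : ℂ) := by
    intro i; push_cast; rfl
  rw [e1]
  simp only [ec, ed]
  have e2 : ((∑ i, ∑ j, (((n i : ℝ) + (m' i : ℝ) / 2 : ℝ) : ℂ) * τ i j *
      (((n j : ℝ) + (m' j : ℝ) / 2 : ℝ) : ℂ)) +
        2 * ∑ i, (((n i : ℝ) + (m' i : ℝ) / 2 : ℝ) : ℂ) *
          (z i + (((m'' i : ℝ) / 2 : ℝ) : ℂ))).im =
      (∑ i, ∑ j, ((n i : ℝ) + (m' i : ℝ) / 2) * (τ i j).im * ((n j : ℝ) + (m' j : ℝ) / 2))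
      + 2 * ∑ i, ((n i : ℝ) + (m' i : ℝ) / 2) * (z i).im := by
    have h2 : ∀ S : ℂ, (2 * S).im = 2 * S.im := by intro S; simp
    rw [Complex.add_im, h2, Complex.im_sum, Complex.im_sum]
    congr 1
    · refine Finset.sum_congr rfl fun i _ => ?_
      rw [Complex.im_sum]
      refine Finset.sum_congr rfl fun j _ => ?_
      rw [Complex.im_mul_ofReal, Complex.im_ofReal_mul]
    · congr 1
      refine Finset.sum_congr rfl fun i _ => ?_
      rw [Complex.im_ofReal_mul, Complex.add_im, Complex.ofReal_im, add_zero]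
  rw [e2]
  have h3 : ∑ i, (c * ((n i : ℝ) + (m' i : ℝ) / 2) ^ 2
      + 2 * ((n i : ℝ) + (m' i : ℝ) / 2) * (z i).im) =
      c * ∑ i, ((n i : ℝ) + (m' i : ℝ) / 2) ^ 2 + 2 * ∑ i, ((n i : ℝ) + (m' i : ℝ) / 2) * (z i).im := by
    rw [Finset.sum_add_distrib, Finset.mul_sum, Finset.mul_sum]
    congr 1
    refine Finset.sum_congr rfl fun i _ => ?_
    ring
  rw [h3, neg_mul, neg_mul, neg_le_neg_iff]
  exact mul_le_mul_of_nonneg_left (by linarith) Real.pi_pos.le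

/-- The sign `e(k) = exp(π i k)`. -/
noncomputable def sg (k : ℤ) : ℂ := Complex.exp (Real.pi * Complex.I * (k : ℂ))

lemma sg_add (a b : ℤ) : sg (a + b) = sg a * sg b := by
  unfold sg; rw [← Complex.exp_add]; congr 1; push_cast; ring

lemma sg_even {a : ℤ} (h : Even a) : sg a = 1 := by
  obtain ⟨k, rfl⟩ := h
  unfold sg
  rw [Complex.exp_eq_one_iff]
  exact ⟨k, by push_cast; ring⟩

lemma sg_odd {a : ℤ} (h : Odd a) : sg a = -1 := by
  obtain ⟨k, rfl⟩ := h
  rw [sg_add, sg_even (by simp)]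
  simp [sg]

lemma sg_congr {a b : ℤ} (h : Even (a - b)) : sg a = sg b := by
  have : a = (a - b) + b := by ring
  rw [this, sg_add, sg_even h, one_mul]

lemma theta_reduce {g : ℕ} (τ : Matrix (Fin g) (Fin g) ℂ) (z : Fin g → ℂ)
    (m' m'' a b : Fin g → ℤ) :
    SiegelTheta g τ z (fun i => m' i + 2 * a i) (fun i => m'' i + 2 * b i) =
      sg (∑ i, m' i * b i) * SiegelTheta g τ z m' m'' := by
  rw [theta_eq, theta_eq, ← tsum_mul_left,
    ← (Equiv.addRight a).tsum_eq (fun n => sg (∑ i, m' i * b i) * thE τ z m' m'' n)]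
  refine tsum_congr fun n => ?_
  rw [Equiv.coe_addRight]
  have h : sg (∑ i, m' i * b i) = sg (∑ i, (2 * (n i + a i) + m' i) * b i) := by
    apply sg_congr
    rw [← Finset.sum_sub_distrib]
    refine Finset.even_sum _ fun i _ => ⟨- ((n i + a i) * b i), by ring⟩
  rw [h, sg, thE, thE, ← Complex.exp_add, ← mul_add]
  congr 2
  push_cast
  rw [add_left_comm]
  congr 1
  · refine Finset.sum_congr rfl fun i _ => Finset.sum_congr rfl fun j _ => ?_
    simp only [Pi.add_apply, Int.cast_add]
    ring
  · rw [Finset.mul_sum, Finset.mul_sum, ← Finset.sum_add_distrib]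
    refine Finset.sum_congr rfl fun i _ => ?_
    simp only [Pi.add_apply, Int.cast_add]
    ring

lemma theta_odd {g : ℕ} (τ : Matrix (Fin g) (Fin g) ℂ) 
    (m' m'' : Fin g → ℤ) (h : Odd (∑ i, m' i * m'' i)) :
    SiegelTheta g τ 0 m' m'' = 0 := by
  have key : SiegelTheta g τ 0 m' m'' = - SiegelTheta g τ 0 m' m'' := by
    conv_lhs => rw [theta_eq, ← ((Equiv.neg _).trans (Equiv.subRight m')).tsum_eq]
    rw [theta_eq, ← tsum_neg]
    refine tsum_congr fun n => ?_
    have h1 : sg (∑ i, (-(2 * n i + m' i) * m'' i)) = -1 := by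
      rw [← sg_odd h]
      apply sg_congr
      rw [← Finset.sum_sub_distrib]
      refine Finset.even_sum _ fun i _ => ⟨- ((n i + m' i) * m'' i), by ring⟩
    rw [neg_eq_neg_one_mul, ← h1, sg, thE, thE, ← Complex.exp_add, ← mul_add]
    congr 2
    push_cast
    rw [add_left_comm]
    congr 1
    · refine Finset.sum_congr rfl fun i _ => Finset.sum_congr rfl fun j _ => ?_
      simp
      ring
    · rw [Finset.mul_sum, Finset.mul_sum, ← Finset.sum_add_distrib]
      refine Finset.sum_congr rfl fun i _ => ?_
      simp
      ring
  exact self_eq_neg.1 key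

/-- A 0/1-vector as an integer vector. -/
def iv {g : ℕ} (s : Fin g → Fin 2) : Fin g → ℤ := fun i => ((s i : ℕ) : ℤ)

/-- The summand in the addition formula. -/
noncomputable def GG {g : ℕ} (τ : Matrix (Fin g) (Fin g) ℂ) (z : Fin g → ℂ)
    (a' a'' b' b'' c' c'' m' m'' : Fin g → ℤ) : ℂ :=
  sg (∑ i, (a' i + b' i + c' i) * m'' i) *
    SiegelTheta g τ 0 (fun i => a' i + b' i + m' i) (fun i => a'' i + b'' i + m'' i) *
    SiegelTheta g τ 0 (fun i => a' i + c' i + m' i) (fun i => a'' i + c'' i + m'' i) *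
    SiegelTheta g τ z (fun i => b' i + c' i + m' i) (fun i => b'' i + c'' i + m'' i) *
    SiegelTheta g τ z m' m''

noncomputable def GT {g : ℕ} (τ : Matrix (Fin g) (Fin g) ℂ) (z : Fin g → ℂ)
    (a' a'' b' b'' c' c'' m' m'' : Fin g → ℤ)
    (N : ((Fin g → ℤ) × (Fin g → ℤ)) × ((Fin g → ℤ) × (Fin g → ℤ))) : ℂ :=
  sg (∑ i, (a' i + b' i + c' i) * m'' i) *
    ((thE τ 0 (fun i => a' i + b' i + m' i) (fun i => a'' i + b'' i + m'' i) N.1.1 *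
    thE τ 0 (fun i => a' i + c' i + m' i) (fun i => a'' i + c'' i + m'' i) N.1.2) *
    (thE τ z (fun i => b' i + c' i + m' i) (fun i => b'' i + c'' i + m'' i) N.2.1 *
    thE τ z m' m'' N.2.2))

lemma summable_GT {g : ℕ} (τ : Matrix (Fin g) (Fin g) ℂ) (hτ : InSiegelUpperHalfSpace τ)
    (z : Fin g → ℂ) (a' a'' b' b'' c' c'' m' m'' : Fin g → ℤ) :
    Summable (fun N => ‖GT τ z a' a'' b' b'' c' c'' m' m'' N‖) := by
  have h := (((summable_thE τ hτ 0 (fun i => a' i + b' i + m' i)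
    (fun i => a'' i + b'' i + m'' i)).mul_norm (summable_thE τ hτ 0 (fun i => a' i + c' i + m' i)
    (fun i => a'' i + c'' i + m'' i))).mul_norm
    ((summable_thE τ hτ z (fun i => b' i + c' i + m' i)
    (fun i => b'' i + c'' i + m'' i)).mul_norm (summable_thE τ hτ z m' m''))).mul_left
      ‖sg (∑ i, (a' i + b' i + c' i) * m'' i)‖
  refine h.congr fun N => ?_
  rw [GT, norm_mul (sg _)]

lemma GG_eq_tsum {g : ℕ} (τ : Matrix (Fin g) (Fin g) ℂ) (hτ : InSiegelUpperHalfSpace τ)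
    (z : Fin g → ℂ) (a' a'' b' b'' c' c'' m' m'' : Fin g → ℤ) :
    GG τ z a' a'' b' b'' c' c'' m' m'' = ∑' N, GT τ z a' a'' b' b'' c' c'' m' m'' N := by
  simp only [GT]
  rw [tsum_mul_left, ← tsum_mul_tsum_of_summable_norm
      ((summable_thE τ hτ 0 (fun i => a' i + b' i + m' i)
    (fun i => a'' i + b'' i + m'' i)).mul_norm (summable_thE τ hτ 0 (fun i => a' i + c' i + m' i)
    (fun i => a'' i + c'' i + m'' i))) ((summable_thE τ hτ z (fun i => b' i + c' i + m' i)
    (fun i => b'' i + c'' i + m'' i)).mul_norm (summable_thE τ hτ z m' m'')),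
    ← tsum_mul_tsum_of_summable_norm (summable_thE τ hτ 0 _ _) (summable_thE τ hτ 0 _ _),
    ← tsum_mul_tsum_of_summable_norm (summable_thE τ hτ z _ _) (summable_thE τ hτ z _ _)]
  simp only [GG, theta_eq]
  ring

/-- The exponent in the new coordinates. -/
noncomputable def XX {g : ℕ} (τ : Matrix (Fin g) (Fin g) ℂ) (z : Fin g → ℂ)
    (a' a'' b' b'' c' c'' r'' : Fin g → ℤ)
    (P : ((Fin g → ℤ) × (Fin g → ℤ)) × ((Fin g → ℤ) × (Fin g → ℤ))) : ℂ :=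
  (∑ i, ∑ j,
    (((P.1.1 i + a' i + b' i : ℂ) / 2 + P.1.2 i) * τ i j * ((P.1.1 j + a' j + b' j : ℂ) / 2 + P.1.2 j)
    + ((P.1.1 i + a' i + c' i : ℂ) / 2 + P.2.1 i) * τ i j *
        ((P.1.1 j + a' j + c' j : ℂ) / 2 + P.2.1 j)
    + ((P.1.1 i + b' i + c' i : ℂ) / 2 + P.2.2 i) * τ i j *
        ((P.1.1 j + b' j + c' j : ℂ) / 2 + P.2.2 j)
    + ((P.1.1 i : ℂ) / 2) * τ i j * ((P.1.1 j : ℂ) / 2)))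
  + ∑ i, ((P.1.1 i : ℂ) * r'' i
    + ((P.1.1 i + a' i + b' i : ℂ) / 2 + P.1.2 i) * (a'' i + b'' i)
    + ((P.1.1 i + a' i + c' i : ℂ) / 2 + P.2.1 i) * (a'' i + c'' i)
    + ((P.1.1 i + b' i + c' i : ℂ) / 2 + P.2.2 i) * (2 * z i + b'' i + c'' i)
    + ((P.1.1 i : ℂ) / 2) * (2 * z i))

/-- The summand in the new coordinates. -/
noncomputable def HH {g : ℕ} (τ : Matrix (Fin g) (Fin g) ℂ) (z : Fin g → ℂ)
    (a' a'' b' b'' c' c'' r' r'' : Fin g → ℤ)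
    (P : ((Fin g → ℤ) × (Fin g → ℤ)) × ((Fin g → ℤ) × (Fin g → ℤ))) : ℂ :=
  (∑ t : Fin g → Fin 2, sg (∑ i, (r' i + P.1.2 i + P.2.1 i + P.2.2 i) * iv t i)) *
    Complex.exp (Real.pi * Complex.I * XX τ z a' a'' b' b'' c' c'' r'' P)

lemma sg_sum_eq_zero {g : ℕ} (v : Fin g → ℤ) (i₀ : Fin g) (h : Odd (v i₀)) :
    ∑ t : Fin g → Fin 2, sg (∑ i, v i * iv t i) = 0 := by
  have h1 : ∀ t : Fin g → Fin 2, sg (∑ i, v i * iv t i) = ∏ i, sg (v i * ((t i : ℕ) : ℤ)) := by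
    intro t
    simp only [sg, iv]
    rw [← Complex.exp_sum, ← Finset.mul_sum]
    push_cast
    rfl
  simp only [h1]
  have h2 := Finset.prod_univ_sum (fun _ : Fin g => (Finset.univ : Finset (Fin 2)))
    (fun i x => sg (v i * ((x : ℕ) : ℤ)))
  rw [Fintype.piFinset_univ] at h2
  rw [← h2]
  apply Finset.prod_eq_zero (Finset.mem_univ i₀)
  rw [Fin.sum_univ_two]
  simp [sg_odd h, sg_even]

/-- The reflection. -/
def refl0 {g : ℕ} (b' : Fin g → ℤ)
    (P : ((Fin g → ℤ) × (Fin g → ℤ)) × ((Fin g → ℤ) × (Fin g → ℤ))) :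
    ((Fin g → ℤ) × (Fin g → ℤ)) × ((Fin g → ℤ) × (Fin g → ℤ)) :=
  ((fun i => P.1.1 i + (b' i + P.1.2 i - P.2.1 i + P.2.2 i),
    fun i => P.1.2 i - (b' i + P.1.2 i - P.2.1 i + P.2.2 i)),
   (P.2.1, fun i => P.2.2 i - (b' i + P.1.2 i - P.2.1 i + P.2.2 i)))

lemma refl0_invol {g : ℕ} (b' : Fin g → ℤ) : Function.Involutive (refl0 b') := by
  rintro ⟨⟨p, a1⟩, ⟨a2, a3⟩⟩
  simp only [refl0, Prod.mk.injEq]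
  refine ⟨⟨?_, ?_⟩, trivial, ?_⟩ <;> funext i <;> ring

lemma HH_refl {g : ℕ} (τ : Matrix (Fin g) (Fin g) ℂ) (z : Fin g → ℂ)
    (a' a'' b' b'' c' c'' r' r'' : Fin g → ℤ)
    (hodd : Odd (∑ i, (b' i + r' i) * (b'' i + r'' i)))
    (P : ((Fin g → ℤ) × (Fin g → ℤ)) × ((Fin g → ℤ) × (Fin g → ℤ))) :
    HH τ z a' a'' b' b'' c' c'' r' r'' (refl0 b' P) = - HH τ z a' a'' b' b'' c' c'' r' r'' P := by
  have hW : ∀ t : Fin g → Fin 2, sg (∑ i, (r' i + (refl0 b' P).1.2 i + (refl0 b' P).2.1 i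
      + (refl0 b' P).2.2 i) * iv t i) =
      sg (∑ i, (r' i + P.1.2 i + P.2.1 i + P.2.2 i) * iv t i) := by
    intro t
    apply sg_congr
    rw [← Finset.sum_sub_distrib]
    refine Finset.even_sum _ fun i _ => ⟨-((b' i + P.1.2 i - P.2.1 i + P.2.2 i) * iv t i), ?_⟩
    simp only [refl0]
    ring
  simp only [HH, hW]
  by_cases hs : ∀ i, Even (r' i + P.1.2 i + P.2.1 i + P.2.2 i)
  · rw [← mul_neg]
    congr 1
    have hX : XX τ z a' a'' b' b'' c' c'' r'' (refl0 b' P) = XX τ z a' a'' b' b'' c' c'' r'' P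
        + ((∑ i, (b' i + P.1.2 i - P.2.1 i + P.2.2 i) * (r'' i - b'' i) : ℤ) : ℂ) := by
      unfold XX
      push_cast
      rw [add_assoc]
      refine congrArg₂ (· + ·) ?_ ?_
      · refine Finset.sum_congr rfl fun i _ => Finset.sum_congr rfl fun j _ => ?_
        simp only [refl0]
        push_cast
        ring
      · rw [← Finset.sum_add_distrib]
        refine Finset.sum_congr rfl fun i _ => ?_
        simp only [refl0]
        push_cast
        ring
    have hd : sg (∑ i, (b' i + P.1.2 i - P.2.1 i + P.2.2 i) * (r'' i - b'' i)) = -1 := by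
      rw [← sg_odd hodd]
      apply sg_congr
      rw [← Finset.sum_sub_distrib]
      refine Finset.even_sum _ fun i _ => ?_
      obtain ⟨k, hk⟩ := hs i
      have : P.1.2 i = k + k - r' i - P.2.1 i - P.2.2 i := by omega
      rw [this]
      exact ⟨(k - P.2.1 i - r' i) * (r'' i - b'' i) - (b' i + r' i) * b'' i, by ring⟩
    rw [hX, mul_add, Complex.exp_add]
    have hd' := hd
    unfold sg at hd'
    rw [hd']
    ring
  · push Not at hs
    obtain ⟨i₀, h₀⟩ := hs
    rw [sg_sum_eq_zero (fun i => r' i + P.1.2 i + P.2.1 i + P.2.2 i) i₀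
      (Int.not_even_iff_odd.1 h₀)]
    simp

lemma tsum_HH {g : ℕ} (τ : Matrix (Fin g) (Fin g) ℂ) (z : Fin g → ℂ)
    (a' a'' b' b'' c' c'' r' r'' : Fin g → ℤ)
    (hodd : Odd (∑ i, (b' i + r' i) * (b'' i + r'' i))) :
    ∑' P, HH τ z a' a'' b' b'' c' c'' r' r'' P = 0 := by
  have h := ((refl0_invol b').toPerm).tsum_eq (fun P => HH τ z a' a'' b' b'' c' c'' r' r'' P)
  simp only [Function.Involutive.coe_toPerm, HH_refl τ z a' a'' b' b'' c' c'' r' r'' hodd] at h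
  rw [tsum_neg] at h
  exact neg_eq_self.1 h

/-- Change of coordinates. -/
def coordE (g : ℕ) : (Fin g → Fin 2) × (((Fin g → ℤ) × (Fin g → ℤ)) × ((Fin g → ℤ) × (Fin g → ℤ)))
    ≃ ((Fin g → ℤ) × (Fin g → ℤ)) × ((Fin g → ℤ) × (Fin g → ℤ)) where
  toFun x := ((fun i => iv x.1 i + 2 * x.2.2.2 i, fun i => x.2.1.1 i - x.2.2.2 i),
    (fun i => x.2.1.2 i - x.2.2.2 i, fun i => x.2.2.1 i - x.2.2.2 i))
  invFun P := (fun i => ⟨(P.1.1 i % 2).toNat, by omega⟩,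
    ((fun i => P.1.2 i + P.1.1 i / 2, fun i => P.2.1 i + P.1.1 i / 2),
     (fun i => P.2.2 i + P.1.1 i / 2, fun i => P.1.1 i / 2)))
  left_inv := by
    rintro ⟨s, ⟨⟨n1, n2⟩, ⟨n3, n4⟩⟩⟩
    have h : ∀ i, (iv s i + 2 * n4 i) / 2 = n4 i := by
      intro i; have := (s i).isLt; simp only [iv]; omega
    simp only [h, Prod.mk.injEq, sub_add_cancel, and_true]
    funext i
    have := (s i).isLt
    apply Fin.ext
    simp only [iv]
    omega
  right_inv := by
    rintro ⟨⟨p, a1⟩, ⟨a2, a3⟩⟩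
    simp only [Prod.mk.injEq, add_sub_cancel_right, and_true]
    funext i
    simp only [iv]
    omega

lemma sum_comb {g : ℕ} (S1 S2 S3 L1 L2 L3 L4 L5 : Fin g → ℂ) (Q1 Q2 Q3 Q4 Q5 : Fin g → Fin g → ℂ)
    (hq : ∀ i j, Q5 i j = Q1 i j + Q2 i j + Q3 i j + Q4 i j)
    (hl : ∀ i, S3 i + L5 i = S1 i + S2 i + 2 * L1 i + 2 * L2 i + 2 * L3 i + 2 * L4 i) :
    ∑ i, S1 i + (∑ i, S2 i + (((∑ i, ∑ j, Q1 i j) + 2 * ∑ i, L1 i + ((∑ i, ∑ j, Q2 i j) +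
      2 * ∑ i, L2 i)) + ((∑ i, ∑ j, Q3 i j) + 2 * ∑ i, L3 i + ((∑ i, ∑ j, Q4 i j) +
      2 * ∑ i, L4 i)))) = ∑ i, S3 i + ((∑ i, ∑ j, Q5 i j) + ∑ i, L5 i) := by
  have h1 : ∑ i, ∑ j, Q5 i j = (∑ i, ∑ j, Q1 i j) + (∑ i, ∑ j, Q2 i j) + (∑ i, ∑ j, Q3 i j)
      + (∑ i, ∑ j, Q4 i j) := by
    simp only [hq, Finset.sum_add_distrib]
  have h2 : ∑ i, (S3 i + L5 i) = ∑ i, (S1 i + S2 i + 2 * L1 i + 2 * L2 i + 2 * L3 i + 2 * L4 i) :=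
    Finset.sum_congr rfl fun i _ => hl i
  simp only [Finset.sum_add_distrib, ← Finset.mul_sum] at h2
  linear_combination -h1 - h2

lemma GT_eq {g : ℕ} (τ : Matrix (Fin g) (Fin g) ℂ) (z : Fin g → ℂ)
    (a' a'' b' b'' c' c'' r' r'' : Fin g → ℤ) (s t : Fin g → Fin 2)
    (N : ((Fin g → ℤ) × (Fin g → ℤ)) × ((Fin g → ℤ) × (Fin g → ℤ))) :
    sg (∑ i, (iv s i * r'' i + iv t i * r' i)) * GT τ z a' a'' b' b'' c' c'' (iv s) (iv t) N =
    sg (∑ i, (r' i + (coordE g (s, N)).1.2 i + (coordE g (s, N)).2.1 i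
      + (coordE g (s, N)).2.2 i) * iv t i) *
    Complex.exp (Real.pi * Complex.I * XX τ z a' a'' b' b'' c' c'' r'' (coordE g (s, N))) := by
  obtain ⟨⟨n1, n2⟩, ⟨n3, n4⟩⟩ := N
  have h1 : sg (∑ i, (iv s i * r'' i + iv t i * r' i)) =
    sg (∑ i, ((iv s i + 2 * n4 i) * r'' i + iv t i * r' i)) := by
    apply sg_congr
    rw [← Finset.sum_sub_distrib]
    exact Finset.even_sum _ fun i _ => ⟨-(n4 i * r'' i), by ring⟩
  have h2 : sg (∑ i, (r' i + (n1 i - n4 i) + (n2 i - n4 i) + (n3 i - n4 i)) * iv t i) =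
    sg (∑ i, (r' i + n1 i + n2 i + n3 i + n4 i + 2 * iv s i + 2 * (a' i + b' i + c' i)) * iv t i) := by
    apply sg_congr
    rw [← Finset.sum_sub_distrib]
    exact Finset.even_sum _ fun i _ =>
      ⟨-((2 * n4 i + iv s i + a' i + b' i + c' i) * iv t i), by ring⟩
  simp only [coordE, Equiv.coe_fn_mk]
  rw [h1, h2]
  simp only [GT, thE, sg, XX, ← Complex.exp_add, ← mul_add]
  congr 2
  push_cast
  apply sum_comb
  · intro i j
    ring
  · intro i
    simp only [Pi.zero_apply]
    ring

lemma riemann {g : ℕ} (τ : Matrix (Fin g) (Fin g) ℂ) (hτ : InSiegelUpperHalfSpace τ)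
    (z : Fin g → ℂ)
    (a' a'' b' b'' c' c'' r' r'' : Fin g → ℤ)
    (hodd : Odd (∑ i, (b' i + r' i) * (b'' i + r'' i))) :
    ∑ s : Fin g → Fin 2, ∑ t : Fin g → Fin 2,
      sg (∑ i, (iv s i * r'' i + iv t i * r' i)) * GG τ z a' a'' b' b'' c' c'' (iv s) (iv t) = 0 := by
  rw [← tsum_HH τ z a' a'' b' b'' c' c'' r' r'' hodd, ← (coordE g).tsum_eq]
  have hN : ∀ s t : Fin g → Fin 2, Summable (fun N => ‖sg (∑ i, (iv s i * r'' i + iv t i * r' i)) *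
      GT τ z a' a'' b' b'' c' c'' (iv s) (iv t) N‖) := by
    intro s t
    simp only [norm_mul]
    exact (summable_GT τ hτ z a' a'' b' b'' c' c'' (iv s) (iv t)).mul_left _
  have hH : ∀ s N, HH τ z a' a'' b' b'' c' c'' r' r'' (coordE g (s, N)) =
      ∑ t : Fin g → Fin 2, sg (∑ i, (iv s i * r'' i + iv t i * r' i)) *
      GT τ z a' a'' b' b'' c' c'' (iv s) (iv t) N := by
    intro s N
    rw [HH, Finset.sum_mul]
    exact Finset.sum_congr rfl fun t _ => (GT_eq τ z a' a'' b' b'' c' c'' r' r'' s t N).symm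
  have hHs : ∀ s, Summable (fun N => ‖HH τ z a' a'' b' b'' c' c'' r' r'' (coordE g (s, N))‖) := by
    intro s
    simp only [hH]
    exact Summable.of_nonneg_of_le (fun _ => norm_nonneg _) (fun N => norm_sum_le _ _)
      (summable_sum fun t _ => hN s t)
  have hS : Summable (fun x => HH τ z a' a'' b' b'' c' c'' r' r'' (coordE g x)) := by
    apply Summable.of_norm
    rw [summable_prod_of_nonneg (fun _ => norm_nonneg _)]
    exact ⟨hHs, summable_of_finite_support (Set.toFinite _)⟩
  rw [hS.tsum_prod, tsum_fintype]
  refine Finset.sum_congr rfl fun s _ => ?_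
  simp only [hH]
  rw [Summable.tsum_finsetSum (fun t _ => (hN s t).of_norm)]
  refine Finset.sum_congr rfl fun t _ => ?_
  rw [tsum_mul_left, GG_eq_tsum τ hτ]

lemma quad_zmod (κ : Fin 7 → ZMod 2) (P : Fin 7 → Fin 7 → ZMod 2) (u : Fin 7 → ZMod 2)
    (h1 : ∀ a, P a a = 1) (h3 : ∀ a b, a < b → P b a = P a b + 1 + u a + u b)
    (hT : ∑ a, κ a = 1) :
    ∑ a, ∑ b, κ a * κ b * P a b = ∑ a, ∑ b, if a ≤ b then κ a * κ b else 0 := by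
  have h2 : (2 : ZMod 2) = 0 := by decide
  have hsq : ∀ a, κ a * κ a = κ a := by
    intro a
    generalize κ a = y
    revert y
    decide
  have e1 : ∑ a, ∑ b, κ a * κ b * P a b = (∑ a, κ a * κ a * P a a)
      + ∑ a, ∑ b, if a < b then κ a * κ b * (P a b + P b a) else 0 := by
    simp [Fin.sum_univ_succ]
    ring
  have e2 : (∑ a, ∑ b, if a ≤ b then κ a * κ b else 0) = (∑ a, κ a * κ a)
      + ∑ a, ∑ b, if a < b then κ a * κ b else 0 := by
    simp [Fin.sum_univ_succ]
    ring
  have e3 : ∀ a b, (if a < b then κ a * κ b * (P a b + P b a) else 0) =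
      (if a < b then κ a * κ b else 0) + (if a < b then κ a * κ b * (u a + u b) else 0) := by
    intro a b
    split_ifs with h
    · rw [h3 a b h]
      linear_combination (κ a * κ b * P a b) * h2
    · simp
  have e4 : ∑ a, ∑ b, (if a < b then κ a * κ b * (u a + u b) else 0) =
      (∑ a, u a * κ a) * (∑ a, κ a) - ∑ a, u a * (κ a * κ a) := by
    simp [Fin.sum_univ_succ]
    ring
  rw [e1, e2]
  simp only [e3, Finset.sum_add_distrib, h1, mul_one]
  rw [e4, hT]
  simp only [hsq]
  ring

/-- Integer combination of characteristics. -/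
def MM (m : Fin 7 → Fin 3 → ℤ) (k : Fin 7 → ℤ) : Fin 3 → ℤ := fun i => ∑ j, k j * m j i

/-- The parity function on coefficient vectors. -/
def ff (k : Fin 7 → ℤ) : ℤ :=
  k 0 * (k 0 + k 1 + k 2 + k 3 + k 4 + k 5 + k 6) + k 1 * (k 1 + k 2 + k 3 + k 4 + k 5 + k 6)
  + k 2 * (k 2 + k 3 + k 4 + k 5 + k 6) + k 3 * (k 3 + k 4 + k 5 + k 6)
  + k 4 * (k 4 + k 5 + k 6) + k 5 * (k 5 + k 6) + k 6 * k 6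

lemma parity_MM (m' m'' : Fin 7 → Fin 3 → ℤ) (hA : IsAronholdChar m' m'') (k : Fin 7 → ℤ)
    (hk : Odd (∑ j, k j)) : Even (∑ i, MM m' k i * MM m'' k i - ff k) := by
  obtain ⟨-, -, hodd, heven, -⟩ := hA
  let P : Fin 7 → Fin 7 → ZMod 2 := fun a b => ((∑ i, m' a i * m'' b i : ℤ) : ZMod 2)
  have h2 : (2 : ZMod 2) = 0 := by decide
  have h1 : ∀ a, P a a = 1 := by
    intro a
    obtain ⟨q, hq⟩ := hodd a
    simp only [P]
    rw [hq]
    push_cast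
    linear_combination (q : ZMod 2) * h2
  have h9 : ∀ a b c, a ≠ b → a ≠ c → b ≠ c →
      P a a + P b b + P c c + P a b + P b a + P a c + P c a + P b c + P c b = 0 := by
    intro a b c hab hac hbc
    obtain ⟨q, hq⟩ := heven a b c hab hac hbc
    have : ((∑ i, (m' a i + m' b i + m' c i) * (m'' a i + m'' b i + m'' c i) : ℤ) : ZMod 2) = 0 := by
      rw [hq]
      push_cast
      linear_combination (q : ZMod 2) * h2
    rw [← this]
    simp only [P, Fin.sum_univ_three]
    push_cast
    ring
  let u : Fin 7 → ZMod 2 := fun a => if a = 6 then 0 else P a 6 + P 6 a + 1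
  have h3 : ∀ a b, a < b → P b a = P a b + 1 + u a + u b := by
    intro a b hab
    have ha : a ≠ 6 := by rintro rfl; exact absurd (Fin.le_last b) (not_le.2 hab)
    by_cases hb : b = 6
    · subst hb
      simp only [u, ha, if_false, if_true]
      linear_combination (- P a 6 - 1) * h2
    · simp only [u, ha, hb, if_false]
      have := h9 a b 6 hab.ne ha hb
      linear_combination this - h1 a - h1 b - h1 6 - (P a b + P a 6 + P 6 a + P b 6 + P 6 b) * h2
        - 3 * h2
  have hT : ∑ a, ((k a : ℤ) : ZMod 2) = 1 := by
    obtain ⟨q, hq⟩ := hk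
    have : ((∑ j, k j : ℤ) : ZMod 2) = 1 := by
      rw [hq]
      push_cast
      linear_combination (q : ZMod 2) * h2
    simpa using this
  have key := quad_zmod (fun a => (k a : ZMod 2)) P u h1 h3 hT
  rw [even_iff_two_dvd, ← Nat.cast_two, ← ZMod.intCast_zmod_eq_zero_iff_dvd]
  have e1 : ((∑ i, MM m' k i * MM m'' k i : ℤ) : ZMod 2) =
      ∑ a, ∑ b, (k a : ZMod 2) * (k b : ZMod 2) * P a b := by
    have : (∑ i, MM m' k i * MM m'' k i : ℤ) =
        ∑ a, ∑ b, k a * k b * ∑ i, m' a i * m'' b i := by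
      simp only [MM, Finset.sum_mul_sum]
      simp only [Finset.mul_sum]
      rw [Finset.sum_comm]
      refine Finset.sum_congr rfl fun a _ => ?_
      rw [Finset.sum_comm]
      refine Finset.sum_congr rfl fun b _ => Finset.sum_congr rfl fun i _ => ?_
      ring
    rw [this]
    simp only [P]
    push_cast
    rfl
  have e2 : ((ff k : ℤ) : ZMod 2) =
      ∑ a, ∑ b, if a ≤ b then (k a : ZMod 2) * (k b : ZMod 2) else 0 := by
    simp [Fin.sum_univ_succ, ff]
    ring
  rw [Int.cast_sub, e1, e2, key, sub_self]

lemma GG_period {g : ℕ} (τ : Matrix (Fin g) (Fin g) ℂ) (z : Fin g → ℂ)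
    (a' a'' b' b'' c' c'' m' m'' u v : Fin g → ℤ) :
    GG τ z a' a'' b' b'' c' c'' (fun i => m' i + 2 * u i) (fun i => m'' i + 2 * v i) =
    GG τ z a' a'' b' b'' c' c'' m' m'' := by
  have e : ∀ (w : Fin g → ℂ) (p' p'' : Fin g → ℤ),
      SiegelTheta g τ w (fun i => p' i + (m' i + 2 * u i)) (fun i => p'' i + (m'' i + 2 * v i)) =
      sg (∑ i, (p' i + m' i) * v i) *
        SiegelTheta g τ w (fun i => p' i + m' i) (fun i => p'' i + m'' i) := by
    intro w p' p''
    rw [← theta_reduce τ w _ _ u v]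
    congr 1 <;> funext i <;> ring
  have hs : sg (∑ i, (a' i + b' i + c' i) * (m'' i + 2 * v i)) *
      sg (∑ i, (a' i + b' i + m' i) * v i) * sg (∑ i, (a' i + c' i + m' i) * v i) *
      sg (∑ i, (b' i + c' i + m' i) * v i) * sg (∑ i, m' i * v i) =
      sg (∑ i, (a' i + b' i + c' i) * m'' i) := by
    simp only [← sg_add, ← Finset.sum_add_distrib]
    apply sg_congr
    rw [← Finset.sum_sub_distrib]
    exact Finset.even_sum _ fun i _ => ⟨2 * ((a' i + b' i + c' i) * v i) + 2 * (m' i * v i), by ring⟩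
  simp only [GG]
  rw [e 0 (fun i => a' i + b' i) (fun i => a'' i + b'' i),
    e 0 (fun i => a' i + c' i) (fun i => a'' i + c'' i),
    e z (fun i => b' i + c' i) (fun i => b'' i + c'' i), theta_reduce, ← hs]
  ring

lemma GG_shift {g : ℕ} (τ : Matrix (Fin g) (Fin g) ℂ) (z : Fin g → ℂ)
    (a' a'' b' b'' c' c'' m' m'' : Fin g → ℤ)
    (hb : Odd (∑ i, b' i * b'' i)) (hc : Odd (∑ i, c' i * c'' i)) :
    GG τ z a' a'' b' b'' c' c'' (fun i => b' i + c' i + m' i) (fun i => b'' i + c'' i + m'' i) =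
    GG τ z a' a'' b' b'' c' c'' m' m'' := by
  have e1 : SiegelTheta g τ 0 (fun i => a' i + b' i + (b' i + c' i + m' i))
      (fun i => a'' i + b'' i + (b'' i + c'' i + m'' i)) = sg (∑ i, (a' i + c' i + m' i) * b'' i) *
      SiegelTheta g τ 0 (fun i => a' i + c' i + m' i) (fun i => a'' i + c'' i + m'' i) := by
    rw [← theta_reduce τ 0 _ _ b' b'']
    congr 1 <;> funext i <;> ring
  have e2 : SiegelTheta g τ 0 (fun i => a' i + c' i + (b' i + c' i + m' i))
      (fun i => a'' i + c'' i + (b'' i + c'' i + m'' i)) = sg (∑ i, (a' i + b' i + m' i) * c'' i) *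
      SiegelTheta g τ 0 (fun i => a' i + b' i + m' i) (fun i => a'' i + b'' i + m'' i) := by
    rw [← theta_reduce τ 0 _ _ c' c'']
    congr 1 <;> funext i <;> ring
  have e3 : SiegelTheta g τ z (fun i => b' i + c' i + (b' i + c' i + m' i))
      (fun i => b'' i + c'' i + (b'' i + c'' i + m'' i)) = sg (∑ i, m' i * (b'' i + c'' i)) *
      SiegelTheta g τ z m' m'' := by
    rw [← theta_reduce τ z _ _ (fun i => b' i + c' i) (fun i => b'' i + c'' i)]
    congr 1 <;> funext i <;> ring
  have hs : sg (∑ i, (a' i + b' i + c' i) * (b'' i + c'' i + m'' i)) *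
      sg (∑ i, (a' i + c' i + m' i) * b'' i) * sg (∑ i, (a' i + b' i + m' i) * c'' i) *
      sg (∑ i, m' i * (b'' i + c'' i)) = sg (∑ i, (a' i + b' i + c' i) * m'' i) := by
    have h0 : sg (∑ i, b' i * b'' i + ∑ i, c' i * c'' i) = 1 := sg_even (hb.add_odd hc)
    rw [← one_mul (sg (∑ i, (a' i + b' i + c' i) * m'' i)), ← h0]
    simp only [← sg_add, ← Finset.sum_add_distrib]
    apply sg_congr
    rw [← Finset.sum_sub_distrib]
    exact Finset.even_sum _ fun i _ => ⟨(a' i + c' i + m' i) * b'' i + (a' i + b' i + m' i) * c'' i,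
      by ring⟩
  simp only [GG]
  rw [e1, e2, e3, ← hs]
  ring

lemma MM_add (m : Fin 7 → Fin 3 → ℤ) (k l : Fin 7 → ℤ) (i : Fin 3) :
    MM m (fun j => k j + l j) i = MM m k i + MM m l i := by
  simp only [MM, add_mul, Finset.sum_add_distrib]

/-- The coefficient vector attached to a 0/1-vector of length 6. -/
def kt (x : Fin 6 → Fin 2) : Fin 7 → ℤ :=
  ![iv x 0, iv x 1, iv x 2, iv x 3, iv x 4, iv x 5,
    1 + (iv x 0 + iv x 1 + iv x 2 + iv x 3 + iv x 4 + iv x 5)]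

lemma kt_odd (x : Fin 6 → Fin 2) : Odd (∑ j, kt x j) := by
  refine ⟨iv x 0 + iv x 1 + iv x 2 + iv x 3 + iv x 4 + iv x 5, ?_⟩
  simp [Fin.sum_univ_succ, kt]
  ring

/-- Unit coefficient vectors. -/
def ee (a : Fin 7) : Fin 7 → ℤ := fun j => if j = a then 1 else 0

lemma MM_ee (m : Fin 7 → Fin 3 → ℤ) (a : Fin 7) (i : Fin 3) : MM m (ee a) i = m a i := by
  simp [MM, ee]

/-- Differences of parities. -/
def dd (k : Fin 7 → ℤ) (a : Fin 7) : ℤ := ff (fun j => k j + (ee a j + ee 6 j)) + ff k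

lemma recover : ∀ x : Fin 6 → Fin 2, ∀ a : Fin 6,
    iv x a = (dd (kt x) 0 + dd (kt x) 1 + dd (kt x) 2 + dd (kt x) 3 + dd (kt x) 4 + dd (kt x) 5
      + dd (kt x) a.castSucc) % 2 := by
  decide +kernel

/-- Reduction modulo 2. -/
def md (v : Fin 3 → ℤ) : Fin 3 → Fin 2 := fun i => ⟨(v i % 2).toNat, by omega⟩

lemma md_spec (v : Fin 3 → ℤ) : v = fun i => iv (md v) i + 2 * (v i / 2) := by
  funext i
  simp only [iv, md]
  omega

lemma md_eq {v w : Fin 3 → ℤ} (h : md v = md w) (i : Fin 3) : ∃ q, v i = w i + 2 * q := by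
  have h1 := congrArg (fun f => iv f i) h
  simp only [iv, md] at h1
  exact ⟨v i / 2 - w i / 2, by omega⟩

lemma quad_congr {v w v2 w2 : Fin 3 → ℤ} (h : md v = md w) (h2 : md v2 = md w2)
    (p p2 : Fin 3 → ℤ) :
    Even (∑ i, (v i + p i) * (v2 i + p2 i) - ∑ i, (w i + p i) * (w2 i + p2 i)) := by
  rw [← Finset.sum_sub_distrib]
  refine Finset.even_sum _ fun i _ => ?_
  obtain ⟨q, hq⟩ := md_eq h i
  obtain ⟨q2, hq2⟩ := md_eq h2 i
  rw [hq, hq2]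
  exact ⟨q * (w2 i + p2 i) + (w i + p i) * q2 + 2 * q * q2, by ring⟩

lemma parity_shift (m' m'' : Fin 7 → Fin 3 → ℤ) (hA : IsAronholdChar m' m'') (x : Fin 6 → Fin 2)
    (l : Fin 7 → ℤ) (hl : Even (∑ j, l j)) :
    Even (∑ i, (MM m' (kt x) i + MM m' l i) * (MM m'' (kt x) i + MM m'' l i)
      - ff (fun j => kt x j + l j)) := by
  have := parity_MM m' m'' hA (fun j => kt x j + l j) (by
    rw [Finset.sum_add_distrib]
    exact (kt_odd x).add_even hl)
  simpa only [MM_add] using this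

lemma phi_inj (m' m'' : Fin 7 → Fin 3 → ℤ) (hA : IsAronholdChar m' m'') :
    Function.Injective (fun x : Fin 6 → Fin 2 => (md (MM m' (kt x)), md (MM m'' (kt x)))) := by
  intro x y hxy
  simp only [Prod.mk.injEq] at hxy
  obtain ⟨h1, h2⟩ := hxy
  have key : ∀ l : Fin 7 → ℤ, Even (∑ j, l j) →
      Even (ff (fun j => kt x j + l j) - ff (fun j => kt y j + l j)) := by
    intro l hl
    have a1 := parity_shift m' m'' hA x l hl
    have a2 := parity_shift m' m'' hA y l hl
    have a3 := quad_congr h1 h2 (MM m' l) (MM m'' l)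
    have := (a3.sub a1).add a2
    ring_nf at this ⊢
    exact this
  have k0 : Even (ff (kt x) - ff (kt y)) := by
    have := key (fun _ => 0) (by simp)
    simpa using this
  have kd : ∀ a, Even (dd (kt x) a - dd (kt y) a) := by
    intro a
    have h := key (fun j => ee a j + ee 6 j) (by
      rw [Finset.sum_add_distrib]
      simp [ee])
    have := h.add k0
    obtain ⟨q, hq⟩ := this
    refine ⟨q, ?_⟩
    simp only [dd]
    linarith
  funext a
  apply Fin.ext
  have hx := recover x a
  have hy := recover y a
  obtain ⟨q0, h0⟩ := kd 0
  obtain ⟨q1, h1⟩ := kd 1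
  obtain ⟨q2, h2⟩ := kd 2
  obtain ⟨q3, h3⟩ := kd 3
  obtain ⟨q4, h4⟩ := kd 4
  obtain ⟨q5, h5⟩ := kd 5
  obtain ⟨q6, h6⟩ := kd a.castSucc
  simp only [iv] at hx hy
  omega

lemma reindex (m' m'' : Fin 7 → Fin 3 → ℤ) (hA : IsAronholdChar m' m'')
    (F : (Fin 3 → ℤ) → (Fin 3 → ℤ) → ℂ)
    (hF : ∀ p q u v : Fin 3 → ℤ, F (fun i => p i + 2 * u i) (fun i => q i + 2 * v i) = F p q) :
    ∑ s : Fin 3 → Fin 2, ∑ t : Fin 3 → Fin 2, F (iv s) (iv t) =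
      ∑ x : Fin 6 → Fin 2, F (MM m' (kt x)) (MM m'' (kt x)) := by
  have hb : Function.Bijective
      (fun x : Fin 6 → Fin 2 => (md (MM m' (kt x)), md (MM m'' (kt x)))) := by
    rw [Fintype.bijective_iff_injective_and_card]
    exact ⟨phi_inj m' m'' hA, by simp⟩
  rw [← Fintype.sum_prod_type' (fun s t => F (iv s) (iv t))]
  rw [← hb.sum_comp (fun st : (Fin 3 → Fin 2) × (Fin 3 → Fin 2) => F (iv st.1) (iv st.2))]
  refine Finset.sum_congr rfl fun x _ => ?_
  conv_rhs => rw [md_spec (MM m' (kt x)), md_spec (MM m'' (kt x))]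
  exact (hF _ _ _ _).symm

/-- Coefficients of `q₁+q₂+q₃+q₄`. -/
def rr : Fin 7 → ℤ := ![1, 1, 1, 1, 0, 0, 0]

/-- The condition for a term to survive. -/
def good (x : Fin 6 → Fin 2) : Prop :=
  ff (fun j => kt x j + (ee 4 j + ee 5 j)) % 2 = 0 ∧
  ff (fun j => kt x j + (ee 4 j + ee 6 j)) % 2 = 0 ∧
  (ff (fun j => kt x j + rr j) + ff (kt x)) % 2 = 1

instance : DecidablePred good := fun x => by unfold good; infer_instance

lemma good_filter : (Finset.univ.filter good) =
    {![1,0,0,0,0,0], ![0,1,0,0,0,0], ![0,0,1,0,0,0], ![0,0,0,1,0,0],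
     ![1,0,0,0,0,1], ![0,1,0,0,0,1], ![0,0,1,0,0,1], ![0,0,0,1,0,1]} := by
  decide +kernel

/-- The weighted summand. -/
noncomputable def FF (τ : Matrix (Fin 3) (Fin 3) ℂ) (z : Fin 3 → ℂ)
    (m' m'' : Fin 7 → Fin 3 → ℤ) (p q : Fin 3 → ℤ) : ℂ :=
  (1 - sg (∑ i, MM m' rr i * MM m'' rr i) * sg (∑ i, (p i * MM m'' rr i + q i * MM m' rr i))) *
    GG τ z (m' 4) (m'' 4) (m' 5) (m'' 5) (m' 6) (m'' 6) p q

lemma FF_sum (τ : Matrix (Fin 3) (Fin 3) ℂ) (hτ : InSiegelUpperHalfSpace τ) (z : Fin 3 → ℂ)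
    (m' m'' : Fin 7 → Fin 3 → ℤ) (hA : IsAronholdChar m' m'') :
    ∑ s : Fin 3 → Fin 2, ∑ t : Fin 3 → Fin 2, FF τ z m' m'' (iv s) (iv t) = 0 := by
  have h1 := riemann τ hτ z (m' 4) (m'' 4) (m' 5) (m'' 5) (m' 6) (m'' 6) 0 0
    (by simpa using hA.2.2.1 5)
  have h2 := riemann τ hτ z (m' 4) (m'' 4) (m' 5) (m'' 5) (m' 6) (m'' 6) (MM m' rr) (MM m'' rr)
    (by
      have h := parity_MM m' m'' hA (fun j => ee 5 j + rr j) (by decide +kernel)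
      simp only [MM_add, MM_ee] at h
      have h' : Odd (ff (fun j => ee 5 j + rr j)) := by decide +kernel
      have := h.add_odd h'
      rwa [sub_add_cancel] at this)
  simp only [Pi.zero_apply, mul_zero, add_zero, Finset.sum_const_zero, sg_even Even.zero,
    one_mul] at h1
  simp only [FF, sub_mul, one_mul, Finset.sum_sub_distrib, h1, mul_assoc, ← Finset.mul_sum, h2]
  simp

lemma FF_period (τ : Matrix (Fin 3) (Fin 3) ℂ) (z : Fin 3 → ℂ)
    (m' m'' : Fin 7 → Fin 3 → ℤ) (p q u v : Fin 3 → ℤ) :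
    FF τ z m' m'' (fun i => p i + 2 * u i) (fun i => q i + 2 * v i) = FF τ z m' m'' p q := by
  rw [FF, FF, GG_period]
  congr 3
  apply sg_congr
  rw [← Finset.sum_sub_distrib]
  exact Finset.even_sum _ fun i _ => ⟨u i * MM m'' rr i + v i * MM m' rr i, by ring⟩

lemma FF_weight (τ : Matrix (Fin 3) (Fin 3) ℂ) (z : Fin 3 → ℂ)
    (m' m'' : Fin 7 → Fin 3 → ℤ) (hA : IsAronholdChar m' m'') (x : Fin 6 → Fin 2) :
    FF τ z m' m'' (MM m' (kt x)) (MM m'' (kt x)) =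
    (1 - sg (ff (fun j => kt x j + rr j) + ff (kt x))) *
    GG τ z (m' 4) (m'' 4) (m' 5) (m'' 5) (m' 6) (m'' 6) (MM m' (kt x)) (MM m'' (kt x)) := by
  rw [FF, ← sg_add]
  congr 2
  apply sg_congr
  have h1 := parity_shift m' m'' hA x rr (by decide +kernel)
  have h2 := parity_MM m' m'' hA (kt x) (kt_odd x)
  have h3 := h1.add h2
  have h4 : ∑ i, (MM m' (kt x) i + MM m' rr i) * (MM m'' (kt x) i + MM m'' rr i) =
      (∑ i, MM m' rr i * MM m'' rr i + ∑ i, (MM m' (kt x) i * MM m'' rr i +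
        MM m'' (kt x) i * MM m' rr i)) + ∑ i, MM m' (kt x) i * MM m'' (kt x) i := by
    rw [← Finset.sum_add_distrib, ← Finset.sum_add_distrib]
    exact Finset.sum_congr rfl fun i _ => by ring
  rw [h4] at h3
  have h5 := h3.sub (even_two_mul (∑ i, MM m' (kt x) i * MM m'' (kt x) i))
  obtain ⟨q, hq⟩ := h5
  exact ⟨q, by linarith⟩

lemma GG_zero (τ : Matrix (Fin 3) (Fin 3) ℂ) (z : Fin 3 → ℂ)
    (m' m'' : Fin 7 → Fin 3 → ℤ) (hA : IsAronholdChar m' m'') (x : Fin 6 → Fin 2) (d : Fin 7)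
    (h : ¬ ff (fun j => kt x j + (ee 4 j + ee d j)) % 2 = 0) :
    SiegelTheta 3 τ 0 (fun i => m' 4 i + m' d i + MM m' (kt x) i)
      (fun i => m'' 4 i + m'' d i + MM m'' (kt x) i) = 0 := by
  apply theta_odd
  have h1 := parity_shift m' m'' hA x (fun j => ee 4 j + ee d j) (by
    rw [Finset.sum_add_distrib]
    simp [ee])
  have h2 : Odd (ff (fun j => kt x j + (ee 4 j + ee d j))) := by
    rw [Int.odd_iff]; omega
  have h3 := h1.add_odd h2
  rw [sub_add_cancel] at h3
  simp only [MM_add, MM_ee] at h3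
  convert h3 using 2
  ring

lemma FF_bad (τ : Matrix (Fin 3) (Fin 3) ℂ) (z : Fin 3 → ℂ)
    (m' m'' : Fin 7 → Fin 3 → ℤ) (hA : IsAronholdChar m' m'') (x : Fin 6 → Fin 2)
    (h : ¬ good x) : FF τ z m' m'' (MM m' (kt x)) (MM m'' (kt x)) = 0 := by
  by_cases h1 : ff (fun j => kt x j + (ee 4 j + ee 5 j)) % 2 = 0
  · by_cases h2 : ff (fun j => kt x j + (ee 4 j + ee 6 j)) % 2 = 0
    · rw [FF_weight τ z m' m'' hA, sg_even, sub_self, zero_mul]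
      rw [Int.even_iff]
      have : ¬ (ff (fun j => kt x j + rr j) + ff (kt x)) % 2 = 1 := fun h3 => h ⟨h1, h2, h3⟩
      omega
    · rw [FF, GG, GG_zero τ z m' m'' hA x 6 h2]
      ring
  · rw [FF, GG, GG_zero τ z m' m'' hA x 5 h1]
    ring

lemma FF_good (τ : Matrix (Fin 3) (Fin 3) ℂ) (z : Fin 3 → ℂ)
    (m' m'' : Fin 7 → Fin 3 → ℤ) (hA : IsAronholdChar m' m'') (x : Fin 6 → Fin 2)
    (h : good x) (k : Fin 7) (u : Fin 7 → ℤ)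
    (hx : (∀ j, kt x j = ee k j + 2 * u j) ∨ ∀ j, kt x j = ee 5 j + ee 6 j + ee k j + 2 * u j) :
    FF τ z m' m'' (MM m' (kt x)) (MM m'' (kt x)) =
      2 * GG τ z (m' 4) (m'' 4) (m' 5) (m'' 5) (m' 6) (m'' 6) (m' k) (m'' k) := by
  rw [FF_weight τ z m' m'' hA, sg_odd (Int.odd_iff.2 h.2.2)]
  have h2 : ∀ m : Fin 7 → Fin 3 → ℤ, MM m (fun j => 2 * u j) = fun i => 2 * MM m u i := by
    intro m
    funext i
    simp only [MM, mul_assoc, Finset.mul_sum]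
  congr 1
  · norm_num
  · rcases hx with hx | hx
    · have e : ∀ m, MM m (kt x) = fun i => m k i + 2 * MM m u i := by
        intro m
        rw [show kt x = fun j => ee k j + 2 * u j from funext hx]
        funext i
        rw [MM_add m (ee k) (fun j => 2 * u j), h2, MM_ee]
      rw [e m', e m'', GG_period]
    · have e : ∀ m, MM m (kt x) = fun i => (m 5 i + m 6 i + m k i) + 2 * MM m u i := by
        intro m
        rw [show kt x = fun j => ee 5 j + ee 6 j + ee k j + 2 * u j from funext hx]
        funext i
        rw [MM_add m (fun j => ee 5 j + ee 6 j + ee k j) (fun j => 2 * u j), h2,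
          MM_add m (fun j => ee 5 j + ee 6 j) (ee k), MM_add, MM_ee, MM_ee, MM_ee]
      rw [e m', e m'', GG_period, GG_shift _ _ _ _ _ _ _ _ _ _ (hA.2.2.1 5) (hA.2.2.1 6)]

lemma GG_sum (τ : Matrix (Fin 3) (Fin 3) ℂ) (hτ : InSiegelUpperHalfSpace τ) (z : Fin 3 → ℂ)
    (m' m'' : Fin 7 → Fin 3 → ℤ) (hA : IsAronholdChar m' m'') :
    GG τ z (m' 4) (m'' 4) (m' 5) (m'' 5) (m' 6) (m'' 6) (m' 0) (m'' 0) +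
    GG τ z (m' 4) (m'' 4) (m' 5) (m'' 5) (m' 6) (m'' 6) (m' 1) (m'' 1) +
    GG τ z (m' 4) (m'' 4) (m' 5) (m'' 5) (m' 6) (m'' 6) (m' 2) (m'' 2) +
    GG τ z (m' 4) (m'' 4) (m' 5) (m'' 5) (m' 6) (m'' 6) (m' 3) (m'' 3) = 0 := by
  have h := FF_sum τ hτ z m' m'' hA
  rw [reindex m' m'' hA _ (FF_period τ z m' m''),
    ← Finset.sum_filter_add_sum_filter_not Finset.univ good,
    Finset.sum_eq_zero (s := Finset.univ.filter fun x => ¬ good x)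
      (fun x hx => FF_bad τ z m' m'' hA x (Finset.mem_filter.1 hx).2), add_zero, good_filter,
    Finset.sum_insert (by decide), Finset.sum_insert (by decide), Finset.sum_insert (by decide),
    Finset.sum_insert (by decide), Finset.sum_insert (by decide), Finset.sum_insert (by decide),
    Finset.sum_insert (by decide), Finset.sum_singleton] at h
  rw [FF_good τ z m' m'' hA ![1,0,0,0,0,0] (by decide +kernel) 0 (ee 6) (by decide +kernel),
    FF_good τ z m' m'' hA ![0,1,0,0,0,0] (by decide +kernel) 1 (ee 6) (by decide +kernel),
    FF_good τ z m' m'' hA ![0,0,1,0,0,0] (by decide +kernel) 2 (ee 6) (by decide +kernel),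
    FF_good τ z m' m'' hA ![0,0,0,1,0,0] (by decide +kernel) 3 (ee 6) (by decide +kernel),
    FF_good τ z m' m'' hA ![1,0,0,0,0,1] (by decide +kernel) 0 (ee 6) (by decide +kernel),
    FF_good τ z m' m'' hA ![0,1,0,0,0,1] (by decide +kernel) 1 (ee 6) (by decide +kernel),
    FF_good τ z m' m'' hA ![0,0,1,0,0,1] (by decide +kernel) 2 (ee 6) (by decide +kernel),
    FF_good τ z m' m'' hA ![0,0,0,1,0,1] (by decide +kernel) 3 (ee 6) (by decide +kernel)] at h
  linear_combination h / 4

/-- The key identity obtained from the addition formula with `u = 0`,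
`n₁ = (q₅+q₆)`, `n₂ = (q₅+q₇)`, `n₃ = (q₆+q₇)`, `n₄ = 0`: for an Aronhold
system `q₁, …, q₇` (indices `0, …, 6` below) and `χ(q) = e((q₅+q₆+q₇)'·q'')`,
`∑_{k=1}^{4} χ(q_k) θ(q₅+q₆+q_k) θ(q₅+q₇+q_k) θ(q₆+q₇+q_k)(z) θ[q_k](z) = 0`
for all `z ∈ ℂ³`. -/
theorem aronhold_theta_linear_relation (τ : Matrix (Fin 3) (Fin 3) ℂ)
    (hτ : InSiegelUpperHalfSpace τ)
    (m' m'' : Fin 7 → Fin 3 → ℤ)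
    (hA : IsAronholdChar m' m'') :
    ∀ z : Fin 3 → ℂ,
      ∑ k : Fin 4,
        Complex.exp (Real.pi * Complex.I *
            ((∑ i, (m' 4 i + m' 5 i + m' 6 i) * m'' (Fin.castLE (by norm_num) k) i : ℤ) : ℂ)) *
          tripleThetaConst τ m' m'' 4 5 (Fin.castLE (by norm_num) k) *
          tripleThetaConst τ m' m'' 4 6 (Fin.castLE (by norm_num) k) *
          SiegelTheta 3 τ z
            (fun i => m' 5 i + m' 6 i + m' (Fin.castLE (by norm_num) k) i)
            (fun i => m'' 5 i + m'' 6 i + m'' (Fin.castLE (by norm_num) k) i) *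
          SiegelTheta 3 τ z (m' (Fin.castLE (by norm_num) k))
            (m'' (Fin.castLE (by norm_num) k)) = 0 := by
  intro z
  have h := GG_sum τ hτ z m' m'' hA
  rw [Fin.sum_univ_four]
  exact h
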